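/- For every n ≥ 1, the position of the n-th occurrence of the letter b in t_a equals the position of the n-th occurrence of the letter a in t_c, and the position of the n-th occurrence of the letter c in t_a equals the position of the n-th occurrence of the letter b in t_c. (That is, t_a codes the same table as t_c.) -/

import Mathlib

inductive ABC : Type | A | B | C
  deriving DecidableEq

/-- The Tribonacci substitution `τ(a) = ab`, `τ(b) = ac`, `τ(c) = a`. -/
def τ : ABC → List ABC
  | .A => [.A, .B]
  | .B => [.A, .C]
  | .C => [.A]

/-- The `n`-th iterate `τⁿ(a)`. -/
def tribIter (n : ℕ) : List ABC := (fun l => l.flatMap τ)^[n] [ABC.A]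

/-- The Tribonacci word `t = abacabaabacab⋯` (0-indexed), the unique fixed point of `τ`
beginning with `a`; since `τⁿ⁺¹(a)` has length greater than `n` and each `τⁿ(a)` is a
prefix of `τⁿ⁺¹(a)`, its `n`-th letter is the `n`-th letter of `τⁿ⁺¹(a)`. -/
def trib (n : ℕ) : ABC := (tribIter (n + 1)).getD n ABC.A

/-- The infinite word (0-indexed) obtained from the Tribonacci word by deleting all
occurrences of the letter `x`. -/
noncomputable def tribDel (x : ABC) (n : ℕ) : ABC :=
  trib (Nat.nth (fun i => trib i ≠ x) n)

/-- The position (1-indexed) of the `n`-th occurrence (`n ≥ 1`) of the letter `x`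
in the infinite word `w` (with `w` given by its letters at 0-indexed places). -/
noncomputable def occ (w : ℕ → ABC) (x : ABC) (n : ℕ) : ℕ :=
  Nat.nth (fun i => w i = x) (n - 1) + 1

theorem tribIter_succ (k : ℕ) : tribIter (k + 1) = (tribIter k).flatMap τ :=
  Function.iterate_succ_apply' _ _ _

theorem tribIter_prefix_succ (k : ℕ) : tribIter k <+: tribIter (k + 1) := by
  induction k with
  | zero => exact ⟨[ABC.B], rfl⟩
  | succ k ih =>
    obtain ⟨l, hl⟩ := ih
    refine ⟨l.flatMap τ, ?_⟩
    rw [tribIter_succ k, ← List.flatMap_append, hl, ← tribIter_succ]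

theorem tribIter_prefix {j k : ℕ} (h : j ≤ k) : tribIter j <+: tribIter k := by
  induction h with
  | refl => exact List.prefix_refl _
  | step _ ih => exact ih.trans (tribIter_prefix_succ _)

theorem count_A_flatMap_τ (l : List ABC) : (l.flatMap τ).count ABC.A = l.length := by
  induction l with
  | nil => rfl
  | cons x l ih => cases x <;> simp [τ, ih]

theorem length_flatMap_τ (l : List ABC) :
    l.length + l.count ABC.A ≤ (l.flatMap τ).length := by
  induction l with
  | nil => simp
  | cons x l ih =>
    rw [List.flatMap_cons, List.length_append]
    cases x <;> simp [τ, -List.length_flatMap] <;> omega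

theorem lt_length_tribIter (k : ℕ) : k < (tribIter k).length := by
  induction k with
  | zero => exact Nat.zero_lt_one
  | succ k ih =>
    have h := length_flatMap_τ (tribIter k)
    have hA : 0 < (tribIter k).count ABC.A :=
      List.count_pos_iff.2 ((tribIter_prefix k.zero_le).subset (List.mem_singleton.2 rfl))
    rw [tribIter_succ]
    omega

theorem trib_eq_getElem {k i : ℕ} (h : i < (tribIter k).length) :
    trib i = (tribIter k)[i] := by
  have hi : i < (tribIter (i + 1)).length := i.lt_succ_self.trans (lt_length_tribIter _)
  rw [trib, List.getD_eq_getElem _ _ hi]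
  rcases le_total k (i + 1) with hk | hk
  · exact ((tribIter_prefix hk).getElem h).symm
  · exact (tribIter_prefix hk).getElem hi

theorem map_trib_range (k : ℕ) :
    (List.range (tribIter k).length).map trib = tribIter k := by
  refine List.ext_getElem (by simp) fun i h₁ h₂ => ?_
  simp [trib_eq_getElem h₂]

theorem getElem_filter_range (p : ℕ → Prop) [DecidablePred p] (m n : ℕ)
    (h : n < ((List.range m).filter (fun i => p i)).length) :
    ((List.range m).filter (fun i => p i))[n] = Nat.nth p n := by
  induction m with
  | zero => simp at h
  | succ m ih =>
    have hc : ((List.range m).filter (fun i => p i)).length = Nat.count p m := by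
      rw [← List.countP_eq_length_filter]; rfl
    simp only [List.range_succ, List.filter_append] at h ⊢
    by_cases hn : n < ((List.range m).filter (fun i => p i)).length
    · rw [List.getElem_append_left hn, ih hn]
    · by_cases hp : p m
      · simp only [List.length_append, List.filter_singleton, hp, decide_true, cond_true,
          List.length_singleton] at h
        obtain rfl : n = Nat.count p m := by omega
        rw [Nat.nth_count hp, List.getElem_append_right (by omega)]
        simp [hp]
      · simp [hp] at h hn
        omega

theorem tribDel_eq_getElem (x : ABC) {k n : ℕ}
    (h : n < ((tribIter k).filter (· ≠ x)).length) :
    tribDel x n = ((tribIter k).filter (· ≠ x))[n] := by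
  have hf : (tribIter k).filter (· ≠ x) =
      ((List.range (tribIter k).length).filter (fun i => trib i ≠ x)).map trib := by
    conv_lhs => rw [← map_trib_range k, List.filter_map]
    rfl
  have hn : n < ((List.range (tribIter k).length).filter (fun i => trib i ≠ x)).length := by
    simpa only [hf, List.length_map] using h
  simp only [hf, List.getElem_map]
  rw [getElem_filter_range (fun i => trib i ≠ x) _ _ hn, tribDel]

/-- The coding `a ↦ b`, `b ↦ c` of the letters surviving in `t_c` by those surviving in `t_a`. -/
def shiftLetter : ABC → ABC
  | .A => .B
  | .B => .C
  | .C => .A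

theorem filter_ne_A_flatMap_τ (l : List ABC) :
    (l.flatMap τ).filter (· ≠ ABC.A) = (l.filter (· ≠ ABC.C)).map shiftLetter := by
  induction l with
  | nil => rfl
  | cons x l ih =>
    rw [List.flatMap_cons, List.filter_append, ih]
    cases x <;> rfl

theorem lt_length_filter_ne_C (n : ℕ) :
    n < ((tribIter (n + 1)).filter (· ≠ ABC.C)).length := by
  have h : (tribIter (n + 1)).count ABC.A ≤ ((tribIter (n + 1)).filter (· ≠ ABC.C)).length := by
    rw [← List.countP_eq_length_filter]
    refine List.countP_mono_left fun x _ hx => ?_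
    cases x <;> simp_all
  rw [tribIter_succ n, count_A_flatMap_τ, ← tribIter_succ] at h
  exact (lt_length_tribIter n).trans_le h

theorem tribDel_A_eq_shiftLetter (n : ℕ) :
    tribDel ABC.A n = shiftLetter (tribDel ABC.C n) := by
  have hC := lt_length_filter_ne_C n
  have hf : (tribIter (n + 2)).filter (· ≠ ABC.A) =
      ((tribIter (n + 1)).filter (· ≠ ABC.C)).map shiftLetter := by
    rw [tribIter_succ (n + 1), filter_ne_A_flatMap_τ]
  have hA : n < ((tribIter (n + 2)).filter (· ≠ ABC.A)).length := by
    rwa [hf, List.length_map]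
  rw [tribDel_eq_getElem ABC.C hC, tribDel_eq_getElem ABC.A hA]
  simp only [hf, List.getElem_map]

/-- For every `n ≥ 1`, the position of the `n`-th occurrence of `b` in `t_a` equals the
position of the `n`-th occurrence of `a` in `t_c`, and the position of the `n`-th
occurrence of `c` in `t_a` equals the position of the `n`-th occurrence of `b` in `t_c`:
`t_a` codes the same table as `t_c`. -/
theorem tribDelA_codes_same_table_as_tribDelC (n : ℕ) (hn : 1 ≤ n) :
    occ (tribDel ABC.A) ABC.B n = occ (tribDel ABC.C) ABC.A n ∧
    occ (tribDel ABC.A) ABC.C n = occ (tribDel ABC.C) ABC.B n := by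
  have hB (i : ℕ) : tribDel ABC.A i = ABC.B ↔ tribDel ABC.C i = ABC.A := by
    rw [tribDel_A_eq_shiftLetter]
    cases tribDel ABC.C i <;> simp [shiftLetter]
  have hC (i : ℕ) : tribDel ABC.A i = ABC.C ↔ tribDel ABC.C i = ABC.B := by
    rw [tribDel_A_eq_shiftLetter]
    cases tribDel ABC.C i <;> simp [shiftLetter]
  simp only [occ, hB, hC, and_self]
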